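/- Let A be a noetherian ring. Then A is J-2 (every finitely generated A-algebra has open regular locus) if and only if every finite A-algebra is J-1 (has open regular locus in its spectrum). -/

import Mathlib

open IsLocalRing in
/-- A noetherian local ring is *regular* if its maximal ideal can be generated by
`d` elements, where `d` is the Krull dimension of the ring. -/
def IsRegularLocal (R : Type*) [CommRing R] [IsLocalRing R] : Prop :=
  IsNoetherianRing R ∧ ∃ s : Finset R, Ideal.span (s : Set R) = maximalIdeal R ∧
    (s.card : WithBot ℕ∞) = ringKrullDim R

/-- A noetherian ring `B` is *J-1* if its regular locus — the set of primes `p` such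
that `B_p` is a regular local ring — is open in `Spec B`. -/
def IsJ1 (B : Type*) [CommRing B] : Prop :=
  IsOpen {p : PrimeSpectrum B | IsRegularLocal (Localization.AtPrime p.asIdeal)}

universe u

open CategoryTheory TensorProduct

/-- `M` has projective dimension at most `n` over `R`. -/
def HasProjDimLE (R : Type u) [CommRing R] (M : Type u) [AddCommGroup M] [Module R M] (n : ℕ) :
    Prop :=
  HasProjectiveDimensionLE (ModuleCat.of.{u} R M) n

namespace HasProjDimLE

variable {R : Type u} [CommRing R] {M N K F : Type u} [AddCommGroup M] [Module R M]
  [AddCommGroup N] [Module R N] [AddCommGroup K] [Module R K] [AddCommGroup F] [Module R F]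

theorem zero_iff : HasProjDimLE R M 0 ↔ Module.Projective R M := by
  rw [HasProjDimLE, ← projective_iff_hasProjectiveDimensionLE_zero, IsProjective.iff_projective]

theorem mono {m n : ℕ} (h : HasProjDimLE R M m) (hmn : m ≤ n) : HasProjDimLE R M n := by
  unfold HasProjDimLE HasProjectiveDimensionLE at *
  exact hasProjectiveDimensionLT_of_ge _ (m + 1) (n + 1) (by omega)

theorem of_retract (i : M →ₗ[R] N) (r : N →ₗ[R] M) (h : r ∘ₗ i = LinearMap.id) {n : ℕ}
    (hN : HasProjDimLE R N n) : HasProjDimLE R M n := by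
  unfold HasProjDimLE HasProjectiveDimensionLE at *
  refine Retract.hasProjectiveDimensionLT (Y := ModuleCat.of R N)
    ⟨ModuleCat.ofHom i, ModuleCat.ofHom r, ?_⟩ _
  rw [← ModuleCat.ofHom_comp, h]
  rfl

theorem of_linearEquiv (e : N ≃ₗ[R] M) {n : ℕ} (hN : HasProjDimLE R N n) : HasProjDimLE R M n :=
  hN.of_retract e.symm.toLinearMap e.toLinearMap (by ext; simp)

theorem of_projective [Module.Projective R M] (n : ℕ) : HasProjDimLE R M n :=
  (zero_iff.2 ‹_›).mono n.zero_le

theorem succ_iff [Module.Projective R F] {f : K →ₗ[R] F} {g : F →ₗ[R] M}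
    (hf : Function.Injective f) (hfg : Function.Exact f g) (hg : Function.Surjective g) (n : ℕ) :
    HasProjDimLE R M (n + 1) ↔ HasProjDimLE R K n := by
  have hS : (ShortComplex.mk (ModuleCat.ofHom f) (ModuleCat.ofHom g) (by
      rw [← ModuleCat.ofHom_comp, hfg.linearMap_comp_eq_zero]; rfl)).ShortExact :=
    { exact := (ShortComplex.ShortExact.moduleCat_exact_iff_function_exact _).2 hfg
      mono_f := (ModuleCat.mono_iff_injective _).2 hf
      epi_g := (ModuleCat.epi_iff_surjective _).2 hg }
  exact hS.hasProjectiveDimensionLT_X₃_iff n ((IsProjective.iff_projective F).1 ‹_›)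

/-- Kernels of surjections from projective modules. -/
theorem succ_iff_ker [Module.Projective R F] {g : F →ₗ[R] M} (hg : Function.Surjective g) (n : ℕ) :
    HasProjDimLE R M (n + 1) ↔ HasProjDimLE R (LinearMap.ker g) n :=
  succ_iff (Submodule.subtype_injective _) (LinearMap.exact_subtype_ker_map g) hg n

theorem localizedModule (S : Submonoid R) {n : ℕ} (h : HasProjDimLE R M n) :
    HasProjDimLE (Localization S) (LocalizedModule S M) n := by
  have : HasProjectiveDimensionLE (ModuleCat.of.{u} R M) n := h
  have := (ModuleCat.of.{u} R M).localizedModule_hasProjectiveDimensionLE n S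
  exact of_linearEquiv (Shrink.linearEquiv.{u} (Localization S) (LocalizedModule S M)) this

end HasProjDimLE

/-- Projective dimension is invariant under a base change that preserves presentations of, and
detects projectivity of, the finite modules in a class closed under syzygies. -/
theorem hasProjDimLE_baseChange_iff {R S : Type u} [CommRing R] [IsNoetherianRing R] [CommRing S]
    [Algebra R S] (P : ∀ (M : Type u) [AddCommGroup M] [Module R M], Prop)
    (hker : ∀ (M : Type u) [AddCommGroup M] [Module R M] (r : ℕ) (f : (Fin r → R) →ₗ[R] M),
      P M → P (LinearMap.ker f))
    (hinj : ∀ (M : Type u) [AddCommGroup M] [Module R M] (r : ℕ) (f : (Fin r → R) →ₗ[R] M),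
      P M → Function.Surjective f →
      Function.Injective ((LinearMap.ker f).subtype.baseChange S))
    (hproj : ∀ (M : Type u) [AddCommGroup M] [Module R M] [Module.Finite R M], P M →
      Module.Projective S (S ⊗[R] M) → Module.Projective R M) (n : ℕ) :
    ∀ (M : Type u) [AddCommGroup M] [Module R M] [Module.Finite R M], P M →
      (HasProjDimLE S (S ⊗[R] M) n ↔ HasProjDimLE R M n) := by
  induction n with
  | zero =>
    intro M _ _ _ hM
    rw [HasProjDimLE.zero_iff, HasProjDimLE.zero_iff]
    exact ⟨hproj M hM, fun _ => inferInstance⟩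
  | succ n ih =>
    intro M _ _ _ hM
    obtain ⟨r, f, hf⟩ := Module.Finite.exists_fin' R M
    rw [HasProjDimLE.succ_iff_ker hf, ← ih (LinearMap.ker f) (hker M r f hM)]
    refine HasProjDimLE.succ_iff (g := f.baseChange S) (hinj M r f hM hf) ?_ ?_ n
    · exact lTensor_exact S (LinearMap.exact_subtype_ker_map f) hf
    · exact LinearMap.lTensor_surjective S hf

theorem one_tmul_quotient_eq_zero_iff {R M : Type*} [CommRing R] [AddCommGroup M] [Module R M]
    {x : R} {m : M} : (1 : R ⧸ Ideal.span {x}) ⊗ₜ[R] m = 0 ↔ ∃ v, m = x • v := by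
  rw [← (quotTensorEquivQuotSMul M (Ideal.span {x})).map_eq_zero_iff,
    quotTensorEquivQuotSMul_mk_one_tmul, Submodule.Quotient.mk_eq_zero,
    Submodule.ideal_span_singleton_smul, Submodule.mem_smul_pointwise_iff_exists]
  simp [eq_comm]

theorem isLocalRing_quotient_span_singleton {R : Type*} [CommRing R] [IsLocalRing R] {x : R}
    (hx : x ∈ IsLocalRing.maximalIdeal R) : IsLocalRing (R ⧸ Ideal.span {x}) :=
  have : Nontrivial (R ⧸ Ideal.span {x}) := Ideal.Quotient.nontrivial_iff.2
    (ne_top_of_le_ne_top Ideal.IsPrime.ne_top' ((Ideal.span_singleton_le_iff_mem _).2 hx))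
  IsLocalRing.of_surjective' (Ideal.Quotient.mk _) Ideal.Quotient.mk_surjective

namespace HasProjDimLE

variable {R : Type u} [CommRing R] [IsNoetherianRing R]

theorem baseChange_iff_of_faithfullyFlat (S : Type u) [CommRing S] [Algebra R S]
    [Module.FaithfullyFlat R S] (M : Type u) [AddCommGroup M] [Module R M] [Module.Finite R M]
    (n : ℕ) : HasProjDimLE S (S ⊗[R] M) n ↔ HasProjDimLE R M n := by
  refine hasProjDimLE_baseChange_iff (R := R) (S := S) (fun M _ _ => True)
    (fun _ _ _ _ _ _ => trivial) ?_ ?_ n M trivial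
  · intro M _ _ r f _ _
    exact Module.Flat.lTensor_preserves_injective_linearMap _ (Submodule.subtype_injective _)
  · intro M _ _ _ _ h
    have := Module.Flat.of_flat_tensorProduct R M S
    have := Module.finitePresentation_of_finite R M
    exact Module.Flat.projective_of_finitePresentation

theorem baseChange_quotient_iff [IsLocalRing R] {x : R} (hx : x ∈ IsLocalRing.maximalIdeal R)
    (hreg : IsSMulRegular R x) (M : Type u) [AddCommGroup M] [Module R M] [Module.Finite R M]
    (hM : IsSMulRegular M x) (n : ℕ) :
    HasProjDimLE (R ⧸ Ideal.span {x}) ((R ⧸ Ideal.span {x}) ⊗[R] M) n ↔ HasProjDimLE R M n := by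
  refine hasProjDimLE_baseChange_iff (R := R) (S := R ⧸ Ideal.span {x})
    (fun M _ _ => IsSMulRegular M x) ?_ ?_ ?_ n M hM
  · intro M _ _ r f _
    have : IsSMulRegular (Fin r → R) x := IsSMulRegular.pi fun _ => hreg
    exact this.submodule _ _
  · intro M _ _ r f hM hf
    rw [← LinearMap.ker_eq_bot, LinearMap.ker_eq_bot']
    intro t ht
    obtain ⟨k, rfl⟩ := TensorProduct.mk_surjective R (LinearMap.ker f) (R ⧸ Ideal.span {x})
      Ideal.Quotient.mk_surjective t
    rw [TensorProduct.mk_apply, LinearMap.baseChange_tmul, one_tmul_quotient_eq_zero_iff] at ht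
    obtain ⟨v, hv⟩ := ht
    have hfv : f v = 0 := hM.right_eq_zero_of_smul (by
      rw [← map_smul, ← hv]
      exact k.2)
    exact one_tmul_quotient_eq_zero_iff.2 ⟨⟨v, hfv⟩, Subtype.ext hv⟩
  · intro M _ _ _ hM h
    have := Module.finitePresentation_of_finite R M
    have := isLocalRing_quotient_span_singleton hx
    have h2 : Module.Free (R ⧸ Ideal.span {x}) ((R ⧸ Ideal.span {x}) ⊗[R] M) :=
      Module.free_of_flat_of_isLocalRing
    have := (Module.free_quotSMulTop_iff_free R M
      (by rwa [IsLocalRing.jacobson_eq_maximalIdeal _ bot_ne_top]) hM).1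
      (Module.Free.of_equiv ((QuotSMulTop.equivQuotTensor x M).extendScalarsOfSurjective
        Ideal.Quotient.mk_surjective).symm)
    exact Module.Projective.of_free

end HasProjDimLE

section EmbeddingDimension

open IsLocalRing

variable {R : Type u} [CommRing R] [IsLocalRing R] [IsNoetherianRing R] {x : R}

theorem exists_span_insert_eq_maximalIdeal (hx : x ∈ maximalIdeal R)
    (hx2 : x ∉ maximalIdeal R ^ 2) :
    ∃ s : Set (maximalIdeal R), s.Finite ∧ s.ncard + 1 ≤ (maximalIdeal R).spanFinrank ∧
      Submodule.span R (insert ⟨x, hx⟩ s) = ⊤ := by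
  set v : CotangentSpace R := (maximalIdeal R).toCotangent ⟨x, hx⟩ with hv
  have hv0 : v ≠ 0 := fun h => hx2 ((Ideal.toCotangent_eq_zero _ _).1 h)
  have hs : LinearIndepOn (ResidueField R) id {v} := LinearIndepOn.singleton (v := id) hv0
  let B := hs.extend (Set.subset_univ _)
  let b : Module.Basis B (ResidueField R) (CotangentSpace R) := Module.Basis.extend hs
  have hvB : v ∈ B := hs.subset_extend _ rfl
  have hfin : B.Finite := Module.Finite.finite_basis b
  have hcard : B.ncard = (maximalIdeal R).spanFinrank := by
    rw [spanFinrank_maximalIdeal_eq_finrank_cotangentSpace, Module.finrank_eq_nat_card_basis b]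
    rfl
  have hspan : Submodule.span (ResidueField R) B = ⊤ := by
    rw [← b.span_eq, show ⇑b = ((↑) : B → _) from Module.Basis.coe_extend hs, Subtype.range_coe]
  obtain ⟨g, hg⟩ := (maximalIdeal R).toCotangent_surjective.hasRightInverse
  refine ⟨g '' (B \ {v}), (hfin.sdiff).image g, ?_, ?_⟩
  · rw [← hcard, ← Set.ncard_sdiff_singleton_add_one hvB hfin]
    exact Nat.add_le_add_right (Set.ncard_image_le hfin.sdiff) 1
  · rw [← CotangentSpace.span_image_eq_top_iff, ← hspan]
    congr 1
    rw [Set.image_insert_eq, Set.image_image]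
    simp only [hg _, Set.image_id']
    rw [← hv, Set.insert_sdiff_singleton, Set.insert_eq_of_mem hvB]

theorem spanFinrank_maximalIdeal_quotient_add_one_le [IsLocalRing (R ⧸ Ideal.span {x})]
    (hx : x ∈ maximalIdeal R) (hx2 : x ∉ maximalIdeal R ^ 2) :
    (maximalIdeal (R ⧸ Ideal.span {x})).spanFinrank + 1 ≤ (maximalIdeal R).spanFinrank := by
  obtain ⟨s, hfin, hcard, hspan⟩ := exists_span_insert_eq_maximalIdeal hx hx2
  refine le_trans (Nat.add_le_add_right ?_ 1) hcard
  have h1 : maximalIdeal R = Ideal.span (insert x ((↑) '' s)) := by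
    have := congrArg (Submodule.map (Submodule.subtype (maximalIdeal R))) hspan
    rw [Submodule.map_span, Submodule.map_top, Submodule.range_subtype, Set.image_insert_eq] at this
    exact this.symm
  have h2 : maximalIdeal (R ⧸ Ideal.span {x}) =
      Ideal.span (Ideal.Quotient.mk (Ideal.span {x}) '' ((↑) '' s)) := by
    rw [← map_maximalIdeal_of_surjective (Ideal.Quotient.mk (Ideal.span {x}))
      Ideal.Quotient.mk_surjective, ← Ideal.map_span]
    conv_lhs => rw [h1]
    rw [Ideal.map_span, Ideal.map_span, Set.image_insert_eq,
      Ideal.Quotient.eq_zero_iff_mem.2 (Ideal.mem_span_singleton_self x), Ideal.span_insert_zero]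
  rw [h2]
  refine (Submodule.spanFinrank_span_le_ncard_of_finite ((hfin.image _).image _)).trans ?_
  exact (Set.ncard_image_le (hfin.image _)).trans (Set.ncard_image_le hfin)

theorem spanFinrank_maximalIdeal_le_add_quotient {J : Ideal R} [IsLocalRing (R ⧸ J)]
    (hJ : J ≤ maximalIdeal R) : (maximalIdeal R).spanFinrank ≤
      J.spanFinrank + (maximalIdeal (R ⧸ J)).spanFinrank := by
  obtain ⟨t, ht, htspan⟩ := Submodule.FG.exists_span_finset_card_eq_spanFinrank
    (IsNoetherian.noetherian J)
  obtain ⟨s, hs, hspan⟩ := Submodule.FG.exists_span_finset_card_eq_spanFinrank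
    (IsNoetherian.noetherian (maximalIdeal (R ⧸ J)))
  obtain ⟨g, hg⟩ := (Ideal.Quotient.mk_surjective (I := J)).hasRightInverse
  have h1 : maximalIdeal R = Ideal.span (t ∪ (g '' s)) := by
    rw [Ideal.span_union, show Ideal.span (t : Set R) = J from htspan]
    have h2 : (Ideal.span (g '' (s : Set (R ⧸ J)))).map (Ideal.Quotient.mk J) =
        maximalIdeal _ := by
      rw [Ideal.map_span, Set.image_image]
      simp only [hg _, Set.image_id']
      exact hspan
    have h3 := congrArg (Ideal.comap (Ideal.Quotient.mk J)) h2
    rw [Ideal.comap_map_of_surjective _ Ideal.Quotient.mk_surjective, ← RingHom.ker_eq_comap_bot,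
      Ideal.mk_ker, ← map_maximalIdeal_of_surjective (Ideal.Quotient.mk J)
      Ideal.Quotient.mk_surjective, Ideal.comap_map_of_surjective _ Ideal.Quotient.mk_surjective,
      ← RingHom.ker_eq_comap_bot, Ideal.mk_ker, sup_eq_left.2 hJ, sup_comm] at h3
    exact h3.symm
  have hfin : (g '' (s : Set (R ⧸ J))).Finite := s.finite_toSet.image g
  rw [h1, ← hs, ← ht]
  refine (Submodule.spanFinrank_span_le_ncard_of_finite (t.finite_toSet.union hfin)).trans ?_
  refine (Set.ncard_union_le _ _).trans (Nat.add_le_add (Set.ncard_coe_finset t).le ?_)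
  exact (Set.ncard_image_le s.finite_toSet).trans (Set.ncard_coe_finset s).le

theorem IsRegularLocalRing.quotient_span_singleton {R : Type u} [CommRing R]
    [IsRegularLocalRing R] {x : R} (hx : x ∈ maximalIdeal R) (hx2 : x ∉ maximalIdeal R ^ 2) :
    IsRegularLocalRing (R ⧸ Ideal.span {x}) := by
  have := isLocalRing_quotient_span_singleton hx
  apply IsRegularLocalRing.of_spanFinrank_maximalIdeal_le
  have h1 := spanFinrank_maximalIdeal_quotient_add_one_le hx hx2
  have h2 := ringKrullDim_le_ringKrullDim_quotient_add_card {x}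
    (by simpa [IsLocalRing.ringJacobson_eq_maximalIdeal] using hx)
  rw [← IsRegularLocalRing.spanFinrank_maximalIdeal] at h2
  have h3 : (((maximalIdeal (R ⧸ Ideal.span {x})).spanFinrank + 1 : ℕ) : WithBot ℕ∞) ≤
      ringKrullDim (R ⧸ Ideal.span {x}) + 1 := by
    refine le_trans (by exact_mod_cast h1) (h2.trans ?_)
    rw [Finset.coe_singleton, Finset.card_singleton, Nat.cast_one]
  rw [Nat.cast_add, Nat.cast_one] at h3
  exact (ENat.WithBot.add_le_add_one_right_iff).1 h3

theorem IsRegularLocalRing.of_quotient_span_singleton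
    (hx : x ∈ maximalIdeal R) (hreg : IsSMulRegular R x)
    [IsRegularLocalRing (R ⧸ Ideal.span {x})] : IsRegularLocalRing R := by
  apply IsRegularLocalRing.of_spanFinrank_maximalIdeal_le
  rw [← ringKrullDim_quotient_span_singleton_succ_eq_ringKrullDim hreg hx,
    ← IsRegularLocalRing.spanFinrank_maximalIdeal]
  have h1 := spanFinrank_maximalIdeal_le_add_quotient ((Ideal.span_singleton_le_iff_mem _).2 hx)
  have h2 := Submodule.spanFinrank_span_le_ncard_of_finite (R := R) (Set.finite_singleton x)
  rw [Set.ncard_singleton] at h2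
  have h3 := h1.trans (Nat.add_le_add_right h2 _)
  rw [add_comm] at h3
  exact_mod_cast h3

theorem exists_mem_maximalIdeal_notMem_sq (hm : maximalIdeal R ≠ ⊥) {T : Set (Ideal R)}
    (hT : T.Finite) (hprime : ∀ p ∈ T, p.IsPrime) (hne : maximalIdeal R ∉ T) :
    ∃ x ∈ maximalIdeal R, x ∉ maximalIdeal R ^ 2 ∧ ∀ p ∈ T, x ∉ p := by
  classical
  by_contra! h
  have h1 : (maximalIdeal R : Set R) ⊆
      ⋃ i ∈ ((insert (maximalIdeal R ^ 2) hT.toFinset : Finset (Ideal R)) : Set (Ideal R)),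
        (i : Set R) := by
    intro x hx
    by_cases hx2 : x ∈ maximalIdeal R ^ 2
    · exact Set.mem_biUnion (x := maximalIdeal R ^ 2) (by simp) hx2
    · obtain ⟨p, hp, hxp⟩ := h x hx hx2
      exact Set.mem_biUnion (x := p) (by simp [hp]) hxp
  obtain ⟨p, hp, hle⟩ := (Ideal.subset_union_prime (f := fun i : Ideal R => i)
    (maximalIdeal R ^ 2) (maximalIdeal R ^ 2) (by
      intro i hi hi2 _
      simp only [Finset.mem_insert, hi2, false_or, Set.Finite.mem_toFinset] at hi
      exact hprime i hi)).1 h1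
  simp only [Finset.mem_insert, Set.Finite.mem_toFinset] at hp
  rcases hp with rfl | hp
  · refine hm (Submodule.eq_bot_of_le_smul_of_le_jacobson_bot (maximalIdeal R) _
      (IsNoetherian.noetherian _) ?_ (IsLocalRing.maximalIdeal_le_jacobson _))
    rwa [smul_eq_mul, ← sq]
  · have := hprime p hp
    exact hne (((maximalIdeal.isMaximal R).eq_of_le this.ne_top hle) ▸ hp)

end EmbeddingDimension

section Serre

open IsLocalRing

theorem IsRegularLocalRing.isField_of_spanFinrank_eq_zero {R : Type u} [CommRing R] [IsLocalRing R]
    [IsNoetherianRing R] (h : (maximalIdeal R).spanFinrank = 0) : IsField R :=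
  isField_iff_maximalIdeal_eq.2
    ((Submodule.spanFinrank_eq_zero_iff_eq_bot (IsNoetherian.noetherian _)).1 h)

theorem IsRegularLocalRing.isDomain (R : Type u) [CommRing R] [IsRegularLocalRing R] :
    IsDomain R := by
  obtain ⟨n, hn⟩ : ∃ n, (maximalIdeal R).spanFinrank ≤ n := ⟨_, le_rfl⟩
  induction n generalizing R with
  | zero => exact (isField_of_spanFinrank_eq_zero (Nat.le_zero.1 hn)).isDomain
  | succ n ih =>
    by_cases h0 : (maximalIdeal R).spanFinrank = 0
    · exact (isField_of_spanFinrank_eq_zero h0).isDomain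
    have hm : maximalIdeal R ≠ ⊥ := fun h => h0 (by rw [h, Submodule.spanFinrank_bot])
    have hne : maximalIdeal R ∉ minimalPrimes R := by
      intro h
      have h1 := (Ideal.height_eq_zero_iff).2 h
      have h2 := IsLocalRing.maximalIdeal_height_eq_ringKrullDim (R := R)
      rw [h1, ← IsRegularLocalRing.spanFinrank_maximalIdeal] at h2
      exact h0 (by exact_mod_cast h2.symm)
    obtain ⟨x, hx, hx2, hxT⟩ := exists_mem_maximalIdeal_notMem_sq hm
      (minimalPrimes.finite_of_isNoetherianRing R) (fun p hp => hp.1.1) hne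
    have := IsRegularLocalRing.quotient_span_singleton hx hx2
    have := ih (R ⧸ Ideal.span {x}) (by
      have := spanFinrank_maximalIdeal_quotient_add_one_le hx hx2
      omega)
    have hprime : (Ideal.span {x}).IsPrime := (Ideal.Quotient.isDomain_iff_prime _).1 this
    obtain ⟨p, hp, hpx⟩ := Ideal.exists_minimalPrimes_le (I := ⊥) (J := Ideal.span {x}) bot_le
    have hpp : p.IsPrime := hp.1.1
    have hbot : p = ⊥ := by
      refine Submodule.eq_bot_of_le_smul_of_le_jacobson_bot (Ideal.span {x}) p
        (IsNoetherian.noetherian _) (fun y hy => ?_)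
        (((Ideal.span_singleton_le_iff_mem _).2 hx).trans (IsLocalRing.maximalIdeal_le_jacobson _))
      obtain ⟨z, rfl⟩ := Ideal.mem_span_singleton'.1 (hpx hy)
      rw [mul_comm]
      exact Submodule.smul_mem_smul (Ideal.mem_span_singleton_self x)
        ((hpp.mem_or_mem hy).resolve_right (hxT p hp))
    exact (IsDomain.of_bot_isPrime R (hbp := hbot ▸ hpp))

theorem HasProjDimLE.of_isField {R : Type u} [CommRing R] (hR : IsField R) (M : Type u)
    [AddCommGroup M] [Module R M] (n : ℕ) : HasProjDimLE R M n := by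
  let := hR.toField
  have : Module.Projective R M := inferInstance
  exact .of_projective n

theorem IsRegularLocalRing.hasProjDimLE (R : Type u) [CommRing R] [IsRegularLocalRing R] (n : ℕ)
    (hn : (maximalIdeal R).spanFinrank ≤ n) (M : Type u) [AddCommGroup M] [Module R M]
    [Module.Finite R M] : HasProjDimLE R M n := by
  induction n generalizing R M with
  | zero => exact .of_isField (isField_of_spanFinrank_eq_zero (Nat.le_zero.1 hn)) M 0
  | succ n ih =>
    by_cases h0 : (maximalIdeal R).spanFinrank = 0
    · exact .of_isField (isField_of_spanFinrank_eq_zero h0) M _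
    have hm : maximalIdeal R ≠ ⊥ := fun h => h0 (by rw [h, Submodule.spanFinrank_bot])
    obtain ⟨x, hx, hx2, -⟩ := exists_mem_maximalIdeal_notMem_sq hm
      (T := ∅) Set.finite_empty (by simp) (by simp)
    have := IsRegularLocalRing.quotient_span_singleton hx hx2
    have := IsRegularLocalRing.isDomain R
    have hx0 : x ≠ 0 := by rintro rfl; exact hx2 (zero_mem _)
    have hreg : IsSMulRegular R x := (IsRegular.of_ne_zero hx0).left.isSMulRegular
    obtain ⟨r, f, hf⟩ := Module.Finite.exists_fin' R M
    rw [HasProjDimLE.succ_iff_ker hf]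
    have : IsSMulRegular (Fin r → R) x := IsSMulRegular.pi fun _ => hreg
    rw [← HasProjDimLE.baseChange_quotient_iff hx hreg _ (this.submodule _ _)]
    apply ih
    have := spanFinrank_maximalIdeal_quotient_add_one_le hx hx2
    omega

theorem one_tmul_ideal_quotient_eq_zero_iff {R M : Type*} [CommRing R] [AddCommGroup M] [Module R M]
    {I : Ideal R} {m : M} : (1 : R ⧸ I) ⊗ₜ[R] m = 0 ↔ m ∈ I • (⊤ : Submodule R M) := by
  rw [← (quotTensorEquivQuotSMul M I).map_eq_zero_iff,
    quotTensorEquivQuotSMul_mk_one_tmul, Submodule.Quotient.mk_eq_zero]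

theorem HasProjDimLE.projective_of_forall_mul_eq_zero {R : Type u} [CommRing R] [IsLocalRing R]
    [IsNoetherianRing R] {s : R} (hs : s ≠ 0) (hsm : ∀ a ∈ maximalIdeal R, s * a = 0) {n : ℕ}
    {M : Type u} [AddCommGroup M] [Module R M] [Module.Finite R M] (h : HasProjDimLE R M n) :
    Module.Projective R M := by
  induction n generalizing M with
  | zero => exact zero_iff.1 h
  | succ n ih =>
    obtain ⟨r, f, hf⟩ := Module.Finite.exists_fin' R M
    have := ih ((succ_iff_ker hf n).1 h)
    have := Module.finitePresentation_of_finite R (LinearMap.ker f)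
    have : Module.Free R (LinearMap.ker f) := Module.free_of_flat_of_isLocalRing
    have := Module.free_of_lTensor_residueField_injective (LinearMap.ker f).subtype f hf
      (LinearMap.exact_subtype_ker_map f) ?_
    · exact Module.Projective.of_free
    change Function.Injective ((LinearMap.ker f).subtype.lTensor (R ⧸ maximalIdeal R))
    rw [← LinearMap.ker_eq_bot, LinearMap.ker_eq_bot']
    intro t ht
    obtain ⟨y, rfl⟩ := TensorProduct.mk_surjective R (LinearMap.ker f) (R ⧸ maximalIdeal R)
      Ideal.Quotient.mk_surjective t
    rw [TensorProduct.mk_apply, LinearMap.lTensor_tmul, one_tmul_ideal_quotient_eq_zero_iff] at ht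
    rw [TensorProduct.mk_apply, one_tmul_ideal_quotient_eq_zero_iff]
    have hsy : s • y = 0 := by
      refine Subtype.ext ?_
      change s • (LinearMap.ker f).subtype y = 0
      refine Submodule.smul_induction_on ht (fun a ha v _ => ?_) (fun u v hu hv => ?_)
      · rw [smul_smul, hsm a ha, zero_smul]
      · rw [smul_add, hu, hv, add_zero]
    let b := Module.Free.chooseBasis R (LinearMap.ker f)
    rw [← b.sum_repr y]
    refine Submodule.sum_mem _ fun i _ => Submodule.smul_mem_smul ?_ trivial
    by_contra hi
    have hu : IsUnit (b.repr y i) := by simpa using hi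
    have h1 : s * b.repr y i = 0 := by
      rw [← smul_eq_mul, ← Finsupp.smul_apply, ← map_smul, hsy, map_zero, Finsupp.zero_apply]
    exact hs ((hu.mul_left_eq_zero).1 h1)

theorem exists_linearMap_maximalIdeal_eq_one {R : Type u} [CommRing R] [IsLocalRing R] {x : R}
    (hx : x ∈ maximalIdeal R) (hx2 : x ∉ maximalIdeal R ^ 2) :
    ∃ φ : maximalIdeal R →ₗ[R] R ⧸ maximalIdeal R, φ ⟨x, hx⟩ = 1 := by
  have hv0 : ((maximalIdeal R).toCotangent ⟨x, hx⟩ : CotangentSpace R) ≠ 0 :=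
    fun h => hx2 ((Ideal.toCotangent_eq_zero _ _).1 h)
  obtain ⟨g, hg⟩ := LinearMap.exists_leftInverse_of_injective
    (LinearMap.toSpanSingleton (ResidueField R) (CotangentSpace R) _)
    (LinearMap.ker_toSpanSingleton _ hv0)
  refine ⟨(g.restrictScalars R) ∘ₗ (maximalIdeal R).toCotangent, ?_⟩
  have := LinearMap.congr_fun hg 1
  rwa [LinearMap.comp_apply, LinearMap.toSpanSingleton_apply, one_smul] at this

theorem HasProjDimLE.maximalIdeal_quotient {R : Type u} [CommRing R] [IsLocalRing R] {x : R}
    [IsLocalRing (R ⧸ Ideal.span {x})] (hx : x ∈ maximalIdeal R) (hx2 : x ∉ maximalIdeal R ^ 2)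
    {n : ℕ}
    (h : HasProjDimLE (R ⧸ Ideal.span {x}) ((R ⧸ Ideal.span {x}) ⊗[R] maximalIdeal R) n) :
    HasProjDimLE (R ⧸ Ideal.span {x})
      ((R ⧸ Ideal.span {x}) ⧸ maximalIdeal (R ⧸ Ideal.span {x})) n := by
  obtain ⟨φ, hφ⟩ := exists_linearMap_maximalIdeal_eq_one hx hx2
  let S := R ⧸ Ideal.span {x}
  have hmap : (maximalIdeal R).map (Ideal.Quotient.mk (Ideal.span {x})) = maximalIdeal S :=
    map_maximalIdeal_of_surjective _ Ideal.Quotient.mk_surjective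
  let i : (S ⧸ maximalIdeal S) →ₗ[S] S ⊗[R] maximalIdeal R :=
    Submodule.liftQ (maximalIdeal S) (LinearMap.toSpanSingleton S _ (1 ⊗ₜ ⟨x, hx⟩)) (by
      rw [← hmap, Ideal.map_le_iff_le_comap]
      intro a ha
      rw [Ideal.mem_comap, LinearMap.mem_ker, LinearMap.toSpanSingleton_apply]
      change (algebraMap R S a) • _ = (0 : S ⊗[R] maximalIdeal R)
      rw [algebraMap_smul, ← TensorProduct.tmul_smul]
      have : a • (⟨x, hx⟩ : maximalIdeal R) = x • ⟨a, ha⟩ := Subtype.ext (mul_comm _ _)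
      rw [this]
      exact one_tmul_quotient_eq_zero_iff.2 ⟨_, rfl⟩)
  let ρ : (R ⧸ maximalIdeal R) →ₗ[R] S ⧸ maximalIdeal S :=
    Submodule.liftQ (maximalIdeal R) (Algebra.linearMap R (S ⧸ maximalIdeal S)) (by
      intro a ha
      rw [LinearMap.mem_ker, Algebra.linearMap_apply,
        IsScalarTower.algebraMap_apply R S (S ⧸ maximalIdeal S)]
      exact Ideal.Quotient.eq_zero_iff_mem.2 (hmap ▸ Ideal.mem_map_of_mem _ ha))
  refine h.of_retract i ((ρ ∘ₗ φ).liftBaseChange S) ?_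
  refine Submodule.linearMap_qext _ (LinearMap.ext_ring ?_)
  have hρ : ρ 1 = 1 := map_one (algebraMap R (S ⧸ maximalIdeal S))
  simp only [LinearMap.comp_apply, Submodule.mkQ_apply, i, Submodule.liftQ_apply,
    LinearMap.toSpanSingleton_apply, one_smul, LinearMap.liftBaseChange_tmul, hφ, hρ]
  rfl

theorem IsRegularLocalRing.of_hasProjDimLE {R : Type u} [CommRing R] [IsLocalRing R]
    [IsNoetherianRing R] {n : ℕ} (h : HasProjDimLE R (R ⧸ maximalIdeal R) n) :
    IsRegularLocalRing R := by
  obtain ⟨e, he⟩ : ∃ e, (maximalIdeal R).spanFinrank ≤ e := ⟨_, le_rfl⟩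
  induction e generalizing R with
  | zero =>
    have h0 : (maximalIdeal R).spanFinrank = 0 := Nat.le_zero.1 he
    apply IsRegularLocalRing.of_spanFinrank_maximalIdeal_le
    rw [h0]
    exact ringKrullDim_nonneg_of_nontrivial
  | succ e ih =>
    by_cases h0 : (maximalIdeal R).spanFinrank = 0
    · exact ih h (by omega)
    have hm : maximalIdeal R ≠ ⊥ := fun h => h0 (by rw [h, Submodule.spanFinrank_bot])
    by_cases hass : maximalIdeal R ∈ associatedPrimes R R
    · obtain ⟨-, s, hs⟩ := isAssociatedPrime_iff.1 hass
      have hs0 : s ≠ 0 := by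
        rintro rfl
        refine Ideal.IsPrime.ne_top' (I := maximalIdeal R) ?_
        rw [hs, Ideal.eq_top_iff_one, Submodule.mem_colon_singleton]
        simp
      have := h.projective_of_forall_mul_eq_zero hs0 fun a ha => by
        rw [hs, Submodule.mem_colon_singleton] at ha
        simpa [mul_comm] using ha
      have := Module.finitePresentation_of_finite R (R ⧸ maximalIdeal R)
      have : Module.Free R (R ⧸ maximalIdeal R) := Module.free_of_flat_of_isLocalRing
      refine absurd ?_ hm
      refine (Submodule.eq_bot_iff _).2 fun a ha => ?_
      refine eq_of_smul_eq_smul (α := R ⧸ maximalIdeal R) fun v => ?_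
      rw [zero_smul]
      obtain ⟨v, rfl⟩ := Ideal.Quotient.mk_surjective v
      exact Ideal.Quotient.eq_zero_iff_mem.2 (Ideal.mul_mem_right v _ ha)
    · obtain ⟨x, hx, hx2, hxT⟩ := exists_mem_maximalIdeal_notMem_sq hm
        (associatedPrimes.finite R R) (fun p hp => hp.isPrime) hass
      have hx0 : x ∈ nonZeroDivisors R := by
        by_contra hx0
        have : x ∈ ((nonZeroDivisors R : Set R)ᶜ) := hx0
        rw [← biUnion_associatedPrimes_eq_compl_nonZeroDivisors] at this
        obtain ⟨p, hp, hxp⟩ := Set.mem_iUnion₂.1 this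
        exact hxT p hp hxp
      have hreg : IsSMulRegular R x := Module.Flat.isSMulRegular_of_nonZeroDivisors hx0
      have := isLocalRing_quotient_span_singleton hx
      have h1 := (HasProjDimLE.succ_iff_ker (Submodule.mkQ_surjective (maximalIdeal R)) n).1
        (h.mono n.le_succ)
      rw [Submodule.ker_mkQ, ← HasProjDimLE.baseChange_quotient_iff hx hreg _
        (hreg.submodule _ _)] at h1
      have : IsRegularLocalRing (R ⧸ Ideal.span {x}) := by
        refine ih ?_ ?_
        · exact h1.maximalIdeal_quotient hx hx2
        · have := spanFinrank_maximalIdeal_quotient_add_one_le hx hx2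
          omega
      exact .of_quotient_span_singleton hx hreg
end Serre

section

open IsLocalRing

instance IsRegularLocalRing.isRegularRing (R : Type u) [CommRing R] [IsRegularLocalRing R] :
    IsRegularRing R := by
  rw [isRegularRing_iff]
  intro q _
  have h1 := (IsRegularLocalRing.hasProjDimLE R _ le_rfl (R ⧸ q)).localizedModule q.primeCompl
  refine IsRegularLocalRing.of_hasProjDimLE (n := (maximalIdeal R).spanFinrank) ?_
  rw [← Localization.AtPrime.map_eq_maximalIdeal]
  exact h1.of_linearEquiv ((LocalizedModule.equivTensorProduct q.primeCompl (R ⧸ q)).trans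
    (Algebra.TensorProduct.quotIdealMapEquivTensorQuot
      (Localization.AtPrime q) q).symm.toLinearEquiv)

theorem IsRegularLocalRing.of_flat {R S : Type u} [CommRing R] [CommRing S] [IsLocalRing R]
    [IsNoetherianRing R] [IsRegularLocalRing S] [Algebra R S] [IsLocalHom (algebraMap R S)]
    [Module.Flat R S] : IsRegularLocalRing R := by
  have : Module.FaithfullyFlat R S := Module.FaithfullyFlat.of_flat_of_isLocalHom
  refine IsRegularLocalRing.of_hasProjDimLE (n := (maximalIdeal S).spanFinrank) ?_
  rw [← HasProjDimLE.baseChange_iff_of_faithfullyFlat S]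
  exact IsRegularLocalRing.hasProjDimLE S _ le_rfl _

end

section Nagata

open IsLocalRing

theorem Ideal.height_add_ringKrullDim_quotient_le {R : Type*} [CommRing R] (P : Ideal R)
    [hP : P.IsPrime] : P.height + ringKrullDim (R ⧸ P) ≤ ringKrullDim R := by
  have : Nonempty (PrimeSpectrum R) := ⟨⟨P, hP⟩⟩
  have h1 : ringKrullDim (R ⧸ P) = Order.coheight (⟨P, hP⟩ : PrimeSpectrum R) := by
    rw [ringKrullDim_quotient, Order.coheight_eq_krullDim_Ici]
    rfl
  have h2 : P.height = Order.height (⟨P, hP⟩ : PrimeSpectrum R) :=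
    PrimeSpectrum.height_eq_orderHeight ⟨P, hP⟩
  rw [h1, h2, ringKrullDim, Order.krullDim_eq_iSup_height_add_coheight_of_nonempty]
  exact_mod_cast le_iSup (fun a : PrimeSpectrum R => Order.height a + Order.coheight a) ⟨P, hP⟩

theorem IsRegularLocalRing.of_quotient_prime {R : Type*} [CommRing R] [IsLocalRing R]
    [IsNoetherianRing R] (J : Ideal R) [hJ : J.IsPrime] [IsRegularLocalRing (R ⧸ J)]
    (h : (J.spanFinrank : ℕ∞) ≤ J.height) : IsRegularLocalRing R := by
  apply IsRegularLocalRing.of_spanFinrank_maximalIdeal_le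
  refine le_trans ?_ J.height_add_ringKrullDim_quotient_le
  rw [← IsRegularLocalRing.spanFinrank_maximalIdeal]
  refine le_trans (b := ((J.spanFinrank + (maximalIdeal (R ⧸ J)).spanFinrank : ℕ) : WithBot ℕ∞))
    ?_ ?_
  · exact_mod_cast spanFinrank_maximalIdeal_le_add_quotient (IsLocalRing.le_maximalIdeal hJ.ne_top)
  · rw [Nat.cast_add]
    gcongr
    exact_mod_cast h

/-- The ring `R` is regular on a nonempty principal open subset of its spectrum. -/
def IsJ0 (R : Type*) [CommRing R] : Prop :=
  ∃ f : R, f ≠ 0 ∧ ∀ (Q : Ideal R) [Q.IsPrime], f ∉ Q → IsRegularLocalRing (Localization.AtPrime Q)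

theorem exists_span_card_map_eq_maximalIdeal {R : Type u} [CommRing R] (P : Ideal R) [P.IsPrime]
    [IsRegularLocalRing (Localization.AtPrime P)] :
    ∃ s : Finset R, (s.card : ℕ∞) ≤ P.height ∧
      (Ideal.span (s : Set R)).map (algebraMap R (Localization.AtPrime P)) =
        maximalIdeal (Localization.AtPrime P) := by
  classical
  obtain ⟨t, ht, hspan⟩ := Submodule.FG.exists_span_finset_card_eq_spanFinrank
    (IsNoetherian.noetherian (maximalIdeal (Localization.AtPrime P)))
  have h1 (y : Localization.AtPrime P) : ∃ b : R, Associated (algebraMap R _ b) y := by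
    obtain ⟨⟨b, u⟩, h⟩ := IsLocalization.surj P.primeCompl y
    obtain ⟨v, hv⟩ := IsLocalization.map_units (Localization.AtPrime P) u
    exact ⟨b, Associated.symm ⟨v, by rw [hv, h]⟩⟩
  choose b hb using h1
  refine ⟨t.image b, ?_, ?_⟩
  · have h2 := IsLocalization.AtPrime.ringKrullDim_eq_height P (Localization.AtPrime P)
    rw [← IsRegularLocalRing.spanFinrank_maximalIdeal, ← ht] at h2
    have h3 : (t.card : ℕ∞) = P.height := by exact_mod_cast h2
    rw [← h3]
    exact_mod_cast Finset.card_image_le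
  · rw [Ideal.map_span, ← hspan, Finset.coe_image, Set.image_image]
    apply le_antisymm
    · rw [Ideal.span_le]
      rintro _ ⟨y, hy, rfl⟩
      exact Ideal.mem_of_dvd _ (hb y).dvd' (Ideal.subset_span hy)
    · refine Submodule.span_le.2 fun y hy => ?_
      exact Ideal.mem_of_dvd _ (hb y).dvd (Ideal.subset_span ⟨y, hy, rfl⟩)

theorem exists_notMem_forall_mul_mem {R : Type*} [CommRing R] [IsNoetherianRing R] (P I : Ideal R)
    [P.IsPrime] (h : P.map (algebraMap R (Localization.AtPrime P)) ≤
      I.map (algebraMap R (Localization.AtPrime P))) :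
    ∃ g ∉ P, ∀ p ∈ P, g * p ∈ I := by
  classical
  obtain ⟨t, ht⟩ := IsNoetherian.noetherian P
  have h1 (p : R) : ∃ g ∈ P.primeCompl, p ∈ t → g * p ∈ I := by
    by_cases hp : p ∈ t
    · obtain ⟨g, hg, hgp⟩ := (IsLocalization.algebraMap_mem_map_algebraMap_iff P.primeCompl
        (Localization.AtPrime P) I p).1 (h (Ideal.mem_map_of_mem _ (ht ▸ Submodule.subset_span hp)))
      exact ⟨g, hg, fun _ => hgp⟩
    · exact ⟨1, one_mem _, fun h => absurd h hp⟩
  choose g hg hgt using h1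
  refine ⟨∏ p ∈ t, g p, prod_mem fun p _ => hg p, fun p hp => ?_⟩
  have : P ≤ Submodule.comap (LinearMap.mulLeft R (∏ p ∈ t, g p)) I := by
    rw [← ht]
    refine Submodule.span_le.2 fun p hp => ?_
    change (∏ p ∈ t, g p) * p ∈ I
    rw [← Finset.prod_erase_mul _ _ hp, mul_assoc]
    exact Ideal.mul_mem_left _ _ (hgt p hp)
  exact this hp

theorem exists_isRegularLocalRing_of_isJ0_quotient {R : Type u} [CommRing R] [IsNoetherianRing R]
    (P : Ideal R) [P.IsPrime] [IsRegularLocalRing (Localization.AtPrime P)]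
    (hP : IsJ0 (R ⧸ P)) :
    ∃ h ∉ P, ∀ (Q : Ideal R) [Q.IsPrime], P ≤ Q → h ∉ Q →
      IsRegularLocalRing (Localization.AtPrime Q) := by
  obtain ⟨s, hs, hspan⟩ := exists_span_card_map_eq_maximalIdeal P
  obtain ⟨g, hgP, hg⟩ := exists_notMem_forall_mul_mem P (Ideal.span (s : Set R))
    (by rw [hspan, Localization.AtPrime.map_eq_maximalIdeal])
  obtain ⟨f, hf0, hf⟩ := hP
  obtain ⟨f, rfl⟩ := Ideal.Quotient.mk_surjective f
  have hfP : f ∉ P := fun h => hf0 (Ideal.Quotient.eq_zero_iff_mem.2 h)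
  have hsP : Ideal.span (s : Set R) ≤ P := by
    rw [← IsLocalization.AtPrime.under_maximalIdeal (Localization.AtPrime P) P, ← hspan]
    exact Ideal.le_comap_map
  refine ⟨f * g, fun h => (Ideal.IsPrime.mem_or_mem ‹_› h).elim hfP hgP, ?_⟩
  intro Q hQ hPQ hfg
  have hfQ : f ∉ Q := fun h => hfg (Ideal.mul_mem_right _ _ h)
  have hgQ : g ∉ Q := fun h => hfg (Ideal.mul_mem_left _ _ h)
  let L := Localization.AtPrime Q
  let J := P.map (algebraMap R L)
  have hdisj : Disjoint (Q.primeCompl : Set R) (P : Set R) :=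
    Set.disjoint_left.2 fun x hx hxP => hx (hPQ hxP)
  have hJ : J.IsPrime := IsLocalization.isPrime_of_isPrime_disjoint Q.primeCompl L P ‹_› hdisj
  have hht : J.height = P.height := IsLocalization.height_map_of_disjoint Q.primeCompl P hdisj
  have hJs : J = (Ideal.span (s : Set R)).map (algebraMap R L) := by
    refine le_antisymm ?_ (Ideal.map_mono hsP)
    rw [Ideal.map_le_iff_le_comap]
    intro p hp
    exact (IsLocalization.algebraMap_mem_map_algebraMap_iff Q.primeCompl L _ p).2 ⟨g, hgQ, hg p hp⟩
  have hJrank : (J.spanFinrank : ℕ∞) ≤ J.height := by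
    rw [hht]
    refine le_trans ?_ hs
    rw [hJs, Ideal.map_span]
    have h1 := Submodule.spanFinrank_span_le_ncard_of_finite (R := L)
      (s.finite_toSet.image (algebraMap R L))
    have h2 := h1.trans ((Set.ncard_image_le s.finite_toSet).trans (Set.ncard_coe_finset s).le)
    exact_mod_cast h2
  let Q' := Q.map (Ideal.Quotient.mk P)
  have hQ' : Q'.IsPrime := Ideal.map_isPrime_of_surjective Ideal.Quotient.mk_surjective
    (by rwa [Ideal.mk_ker])
  have hsub : Algebra.algebraMapSubmonoid (R ⧸ P) Q.primeCompl = Q'.primeCompl := by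
    ext x
    obtain ⟨x, rfl⟩ := Ideal.Quotient.mk_surjective x
    constructor
    · rintro ⟨y, hy, hxy⟩ hx
      exact hy ((Ideal.mem_quotient_iff_mem hPQ).1 (hxy ▸ hx))
    · intro hx
      exact ⟨x, fun h => hx ((Ideal.mem_quotient_iff_mem hPQ).2 h), rfl⟩
  have hloc : IsLocalization.AtPrime (L ⧸ J) Q' := by
    have : IsLocalization (Algebra.algebraMapSubmonoid (R ⧸ P) Q.primeCompl) (L ⧸ J) :=
      inferInstanceAs (IsLocalization _ (L ⧸ P.map (algebraMap R L)))
    rw [IsLocalization.AtPrime, ← hsub]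
    exact this
  have := hf Q' fun h => hfQ ((Ideal.mem_quotient_iff_mem hPQ).1 h)
  have : IsRegularLocalRing (L ⧸ J) := IsRegularLocalRing.of_ringEquiv
    (IsLocalization.algEquiv Q'.primeCompl (Localization.AtPrime Q') (L ⧸ J)).toRingEquiv
  exact IsRegularLocalRing.of_quotient_prime J hJrank

theorem IsRegularRing.localization_atPrime_of_isLocalization {R S : Type*} [CommRing R]
    [CommRing S] [Algebra R S] (M : Submonoid R) [IsLocalization M S] [IsRegularRing S]
    (P : Ideal R) [hP : P.IsPrime] (h : Disjoint (M : Set R) (P : Set R)) :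
    IsRegularLocalRing (Localization.AtPrime P) := by
  have hp := IsLocalization.isPrime_of_isPrime_disjoint M S P hP h
  have := IsLocalization.isLocalization_isLocalization_atPrime_isLocalization M
    (Localization.AtPrime (P.map (algebraMap R S))) (P.map (algebraMap R S))
  have h2 : (P.map (algebraMap R S)).comap (algebraMap R S) = P :=
    IsLocalization.under_map_of_isPrime_disjoint M S hP h
  simp only [h2] at this
  exact IsRegularLocalRing.of_ringEquiv
    (IsLocalization.algEquiv P.primeCompl (Localization.AtPrime (P.map (algebraMap R S)))
      (Localization.AtPrime P)).toRingEquiv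

theorem IsRegularLocalRing.of_le {R : Type u} [CommRing R] {P Q : Ideal R} [P.IsPrime] [Q.IsPrime]
    (h : P ≤ Q) [IsRegularLocalRing (Localization.AtPrime Q)] :
    IsRegularLocalRing (Localization.AtPrime P) :=
  IsRegularRing.localization_atPrime_of_isLocalization (S := Localization.AtPrime Q) Q.primeCompl P
    (Set.disjoint_left.2 fun _ hx hxP => hx (h hxP))

theorem isRegularLocal_iff {R : Type*} [CommRing R] [IsLocalRing R] :
    IsRegularLocal R ↔ IsRegularLocalRing R := by
  constructor
  · rintro ⟨hR, s, hs, hcard⟩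
    apply IsRegularLocalRing.of_spanFinrank_maximalIdeal_le
    rw [← hcard, ← hs]
    have := Submodule.spanFinrank_span_le_ncard_of_finite (R := R) s.finite_toSet
    rw [Set.ncard_coe_finset] at this
    exact_mod_cast this
  · intro h
    obtain ⟨s, hs, hspan⟩ := Submodule.FG.exists_span_finset_card_eq_spanFinrank
      (IsNoetherian.noetherian (maximalIdeal R))
    exact ⟨inferInstance, s, hspan, by rw [hs, IsRegularLocalRing.spanFinrank_maximalIdeal]⟩

theorem isJ1_of_forall_isJ0_quotient {R : Type u} [CommRing R] [IsNoetherianRing R]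
    (h : ∀ (P : Ideal R) [P.IsPrime], IsJ0 (R ⧸ P)) : IsJ1 R := by
  classical
  rw [IsJ1]
  simp only [isRegularLocal_iff]
  set U := {p : PrimeSpectrum R | IsRegularLocalRing (Localization.AtPrime p.asIdeal)} with hU
  rw [← isClosed_compl_iff, ← closure_subset_iff_isClosed]
  intro P hP hPU
  rw [← PrimeSpectrum.zeroLocus_vanishingIdeal_eq_closure] at hP
  set K := PrimeSpectrum.vanishingIdeal Uᶜ with hK
  have hKP : K ≤ P.asIdeal := hP
  obtain ⟨P0, hP0, hP0P⟩ := Ideal.exists_minimalPrimes_le hKP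
  have := hP0.1.1
  have hreg : IsRegularLocalRing (Localization.AtPrime P.asIdeal) := hPU
  have := IsRegularLocalRing.of_le hP0P
  obtain ⟨g, hgP0, hg⟩ := exists_isRegularLocalRing_of_isJ0_quotient P0 (h P0)
  have hfin := Ideal.finite_minimalPrimes_of_isNoetherianRing R K
  have h1 (p : Ideal R) : ∃ a ∉ P0, p ∈ K.minimalPrimes → p ≠ P0 → a ∈ p := by
    by_cases hp : p ∈ K.minimalPrimes ∧ p ≠ P0
    · have : ¬ p ≤ P0 := fun hle => hp.2 (le_antisymm hle (hP0.2 hp.1.1 hle))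
      obtain ⟨a, ha, haP⟩ := SetLike.not_le_iff_exists.1 this
      exact ⟨a, haP, fun _ _ => ha⟩
    · exact ⟨1, (Ideal.ne_top_iff_one P0).1 Ideal.IsPrime.ne_top', fun h1 h2 => absurd ⟨h1, h2⟩ hp⟩
  choose a haP0 ha using h1
  have hprod : ∏ p ∈ hfin.toFinset, a p ∈ P0.primeCompl := prod_mem fun p _ => haP0 p
  have hmem : g * ∏ p ∈ hfin.toFinset, a p ∈ K := by
    refine (PrimeSpectrum.mem_vanishingIdeal _ _).2 fun Q hQ => ?_
    have hKQ : K ≤ Q.asIdeal := by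
      intro x hx
      rw [hK, PrimeSpectrum.mem_vanishingIdeal] at hx
      exact hx Q hQ
    obtain ⟨p, hp, hpQ⟩ := Ideal.exists_minimalPrimes_le hKQ
    by_cases hpP : p = P0
    · subst hpP
      refine Ideal.mul_mem_right _ _ ?_
      by_contra hgQ
      exact hQ (hg Q.asIdeal hpQ hgQ)
    · refine Ideal.mul_mem_left _ _ (hpQ ?_)
      exact Ideal.mem_of_dvd _ (Finset.dvd_prod_of_mem a (hfin.mem_toFinset.2 hp)) (ha p hp hpP)
  exact (Ideal.IsPrime.mem_or_mem ‹P0.IsPrime› (hP0.1.2 hmem)).elim hgP0 hprod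

end Nagata

section SeparatingSubset

open IntermediateField

variable {k K : Type*} [Field k] [Field K] [Algebra k K]

theorem exists_subset_isTranscendenceBasis_and_isSeparable [PerfectField k] {S : Set K}
    (hS : S.Finite) (hadj : adjoin k S = ⊤) :
    ∃ t ⊆ S, IsTranscendenceBasis k ((↑) : t → K) ∧ Algebra.IsSeparable (adjoin k t) K := by
  have halg : Algebra.IsAlgebraic (Algebra.adjoin k S) K := by
    rw [← isAlgebraic_adjoin_iff_top, hadj, Algebra.isAlgebraic_iff_isIntegral]
    exact Algebra.isIntegral_of_surjective topEquiv.surjective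
  obtain ⟨t₀, ht₀S, ht₀⟩ := exists_isTranscendenceBasis_subset (R := k) S
  obtain _ | ⟨p, hp, hpk⟩ := CharP.exists' k
  · have : Algebra.IsAlgebraic (adjoin k t₀) K := by
      convert! ht₀.isAlgebraic_field <;> simp
    exact ⟨t₀, ht₀S, ht₀, inferInstance⟩
  have : ExpChar k p := .prime hp.out
  have : CharP K p := .of_ringHom_of_ne_zero (algebraMap k K) p hp.out.ne_zero
  have H (s : Finset K) (hs : LinearIndepOn k _root_.id (s : Set K)) :
      LinearIndepOn k (· ^ p) (s : Set K) := by
    refine hs.map_of_injective_injective (frobeniusEquiv k p).symm (frobenius K p).toAddMonoidHom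
      ?_ ?_ ?_
    · simp
    · simp [frobenius]
    · intro r m
      change ((frobeniusEquiv k p).symm r • m) ^ p = r • m ^ p
      rw [Algebra.smul_def, Algebra.smul_def, mul_pow, ← map_pow, frobeniusEquiv_symm_pow_p]
  have hfin : {t : Set K | t ⊆ S ∧ IsTranscendenceBasis k ((↑) : t → K)}.Finite :=
    hS.finite_subsets.subset fun t ht => ht.1
  obtain ⟨t, ⟨htS, ht⟩, hmax⟩ := hfin.exists_maximalFor
    (fun t => (separableClosure (adjoin k t) K).restrictScalars k) _ ⟨t₀, ht₀S, ht₀⟩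
  refine ⟨t, htS, ht, ?_⟩
  rw [← separableClosure.eq_top_iff, ← (restrictScalars_injective k).eq_iff,
    restrictScalars_top, eq_top_iff, ← hadj, adjoin_le_iff]
  intro n hnS
  by_contra hn
  have hnt : n ∉ t := fun h => hn (le_restrictScalars_separableClosure _ (subset_adjoin _ _ h))
  obtain ⟨i, hi₁, hi₂⟩ := exists_isTranscendenceBasis_and_isSeparable_of_linearIndepOn_pow'
    p hp.out (a := _root_.id) H t n ht hnt
  rw [Set.image_id] at hi₂
  have hsub : insert n t \ {i} ⊆ S :=
    Set.sdiff_subset.trans (Set.insert_subset hnS htS)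
  refine not_lt_iff_le_imp_ge.mpr (hmax ⟨hsub, hi₁⟩)
    (SetLike.lt_iff_le_and_exists.mpr ⟨?_, n, ?_, hn⟩)
  · rw [separableClosure_le_separableClosure_iff, adjoin_le_iff]
    intro x hx
    obtain rfl | ne := eq_or_ne x i
    exacts [hi₂, le_restrictScalars_separableClosure _ (subset_adjoin _ _ ⟨.inr hx, ne⟩)]
  · obtain rfl | ne := eq_or_ne n i
    exacts [hi₂, le_restrictScalars_separableClosure _ (subset_adjoin _ _ ⟨.inl rfl, ne⟩)]

end SeparatingSubset

section SeparableRoot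

open Polynomial

/-- `x` is a simple root of some polynomial all of whose coefficients lie in `R`. -/
def IsSimpleRootOver {K : Type*} [Field K] (R : Set K) (x : K) : Prop :=
  ∃ f : K[X], (∀ n, f.coeff n ∈ R) ∧ f.eval x = 0 ∧ (derivative f).eval x ≠ 0

namespace IsSimpleRootOver

variable {K : Type*} [Field K] {R R' : Set K} {x : K}

theorem mono (h : IsSimpleRootOver R x) (hR : R ⊆ R') : IsSimpleRootOver R' x :=
  let ⟨f, hf, h⟩ := h
  ⟨f, fun n => hR (hf n), h⟩

theorem map {L : Type*} [Field L] (h : IsSimpleRootOver R x) (φ : K →+* L) :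
    IsSimpleRootOver (φ '' R) (φ x) := by
  obtain ⟨f, hf, h0, h1⟩ := h
  refine ⟨f.map φ, fun n => ⟨_, hf n, (coeff_map φ n).symm⟩, ?_, ?_⟩
  · rw [eval_map_apply, h0, map_zero]
  · rw [derivative_map, eval_map_apply]
    simpa using h1

theorem of_map {L : Type*} [Field L] (φ : K →+* L) (h : IsSimpleRootOver (φ '' R) (φ x)) :
    IsSimpleRootOver R x := by
  obtain ⟨f, hf, h0, h1⟩ := h
  obtain ⟨f, rfl⟩ := (lifts_iff_coeff_lifts f).2 fun n => Set.image_subset_range _ _ (hf n)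
  rw [coe_mapRingHom, eval_map_apply, map_eq_zero] at h0
  rw [coe_mapRingHom, derivative_map, eval_map_apply, _root_.map_ne_zero] at h1
  refine ⟨f, fun n => φ.injective.mem_set_image.1 ?_, h0, h1⟩
  simpa using hf n

theorem exists_finite (h : IsSimpleRootOver R x) :
    ∃ F ⊆ R, F.Finite ∧ IsSimpleRootOver F x := by
  obtain ⟨f, hf, h⟩ := h
  refine ⟨Set.range f.coeff, by rintro _ ⟨n, rfl⟩; exact hf n, ?_, f, fun n => ⟨n, rfl⟩, h⟩
  refine ((f.support.finite_toSet.image f.coeff).union (Set.finite_singleton 0)).subset ?_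
  rintro _ ⟨n, rfl⟩
  by_cases hn : f.coeff n = 0
  · exact Or.inr hn
  · exact Or.inl ⟨n, mem_support_iff.2 hn, rfl⟩

theorem of_forall_exists_mul_mem (h : IsSimpleRootOver R x) (W : Subring K)
    (hW : ∀ c ∈ R, ∃ a ∈ W, a ≠ 0 ∧ a * c ∈ W) : IsSimpleRootOver (W : Set K) x := by
  obtain ⟨f, hf, h0, h1⟩ := h
  choose a ha ha0 hac using hW
  have hb : ∏ n ∈ f.support, a _ (hf n) ≠ 0 := Finset.prod_ne_zero_iff.2 fun n _ => ha0 _ _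
  refine ⟨C (∏ n ∈ f.support, a _ (hf n)) * f, fun n => ?_, ?_, ?_⟩
  · rw [coeff_C_mul]
    by_cases hn : n ∈ f.support
    · rw [← Finset.prod_erase_mul _ _ hn, mul_assoc]
      exact W.mul_mem (prod_mem fun n _ => ha _ _) (hac _ _)
    · rw [notMem_support_iff.1 hn, mul_zero]
      exact W.zero_mem
  · rw [eval_mul, h0, mul_zero]
  · rw [derivative_C_mul, eval_mul, eval_C]
    exact mul_ne_zero hb h1

theorem of_isSeparable {k : Type*} [Field k] [Algebra k K] (h : IsSeparable k x) :
    IsSimpleRootOver (Set.range (algebraMap k K)) x := by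
  refine ⟨(minpoly k x).map (algebraMap k K), fun n => ⟨_, (coeff_map _ n).symm⟩, ?_, ?_⟩
  · rw [eval_map_algebraMap, minpoly.aeval]
  · rw [derivative_map, eval_map_algebraMap]
    exact h.aeval_derivative_ne_zero (minpoly.aeval k x)

theorem isSeparable {k : Type*} [Field k] [Algebra k K]
    (h : IsSimpleRootOver (Set.range (algebraMap k K)) x) : IsSeparable k x := by
  obtain ⟨f, hf, h0, h1⟩ := h
  obtain ⟨f, rfl⟩ := (lifts_iff_coeff_lifts f).2 hf
  rw [coe_mapRingHom, eval_map_algebraMap] at h0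
  rw [coe_mapRingHom, derivative_map, eval_map_algebraMap] at h1
  have hf0 : f ≠ 0 := by
    rintro rfl
    simp at h1
  have hx : IsIntegral k x := isAlgebraic_iff_isIntegral.1 ⟨f, hf0, h0⟩
  rw [IsSeparable, separable_iff_derivative_ne_zero (minpoly.irreducible hx)]
  intro hd
  obtain ⟨g, rfl⟩ := minpoly.dvd k x h0
  rw [derivative_mul, hd, zero_mul, zero_add, map_mul, minpoly.aeval, zero_mul] at h1
  exact h1 rfl

end IsSimpleRootOver

theorem exists_subset_algebraicIndependent_and_isSimpleRootOver {k Ω : Type*} [Field k] [Field Ω]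
    [Algebra k Ω] [PerfectField k] {S : Set Ω} (hS : S.Finite) :
    ∃ t ⊆ S, AlgebraicIndependent k ((↑) : t → Ω) ∧
      ∀ s ∈ S, IsSimpleRootOver (Algebra.adjoin k t : Set Ω) s := by
  let K := IntermediateField.adjoin k S
  have hSK : S ⊆ K := IntermediateField.subset_adjoin k S
  have himg : K.val '' (K.val ⁻¹' S) = S := by
    rw [Set.image_preimage_eq_iff]
    exact fun s hs => ⟨⟨s, hSK hs⟩, rfl⟩
  have hadj : IntermediateField.adjoin k (K.val ⁻¹' S) = ⊤ := by
    apply IntermediateField.map_injective K.val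
    rw [IntermediateField.adjoin_map, himg, ← AlgHom.fieldRange_eq_map,
      IntermediateField.fieldRange_val]
  obtain ⟨t, htS, ht, hsep⟩ := exists_subset_isTranscendenceBasis_and_isSeparable
    (hS.preimage K.val.injective.injOn) hadj
  refine ⟨K.val '' t, by rw [← himg]; exact Set.image_mono htS, ?_, ?_⟩
  · have h1 := (ht.1.map' (f := K.val) K.val.injective)
    have h2 := h1.coe_range
    have : Set.range (K.val ∘ ((↑) : t → K)) = K.val '' t := by
      rw [Set.range_comp, Subtype.range_coe]
    rwa [this] at h2
  · intro s hs
    have h1 := IsSimpleRootOver.of_isSeparable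
      (hsep.isSeparable (F := IntermediateField.adjoin k t) (⟨s, hSK hs⟩ : K))
    have h2 := h1.of_forall_exists_mul_mem (Algebra.adjoin k t).toSubring ?_
    · refine (h2.map K.val.toRingHom).mono ?_
      rintro _ ⟨c, hc, rfl⟩
      have : K.val c ∈ (Algebra.adjoin k t).map K.val := ⟨c, hc, rfl⟩
      rwa [AlgHom.map_adjoin] at this
    · rintro _ ⟨c, rfl⟩
      obtain ⟨a, ha, b, hb, hab⟩ := IntermediateField.mem_adjoin_iff_div.1 c.2
      change ∃ d ∈ (Algebra.adjoin k t).toSubring, d ≠ 0 ∧ d * (c : K) ∈ _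
      rw [hab]
      by_cases hb0 : b = 0
      · exact ⟨1, one_mem _, one_ne_zero, by simp [hb0]⟩
      · exact ⟨b, hb, hb0, by rwa [mul_div_cancel₀ _ hb0]⟩

end SeparableRoot

section GenericRegularity

open IsLocalRing

theorem IsRegularLocalRing.localization_atPrime_of_map {R S : Type*} [CommRing R] [CommRing S]
    [Algebra R S] (M : Submonoid R) [IsLocalization M S] (P : Ideal S) [P.IsPrime] :
    IsRegularLocalRing (Localization.AtPrime P) ↔
      IsRegularLocalRing (Localization.AtPrime (P.under R)) := by
  have := IsLocalization.isLocalization_isLocalization_atPrime_isLocalization M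
    (Localization.AtPrime P) P
  let e := (IsLocalization.algEquiv (P.under R).primeCompl (Localization.AtPrime P)
      (Localization.AtPrime (P.under R))).toRingEquiv
  exact ⟨fun h => .of_ringEquiv e, fun h => .of_ringEquiv e.symm⟩

theorem IsJ0.of_isRegularRing_away {R S : Type*} [CommRing R] [CommRing S] [Algebra R S] {f : R}
    (hf : f ≠ 0) [IsLocalization.Away f S] [IsRegularRing S] : IsJ0 R := by
  refine ⟨f, hf, fun Q hQ hfQ => ?_⟩
  exact IsRegularRing.localization_atPrime_of_isLocalization (S := S) (Submonoid.powers f) Q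
    ((Ideal.disjoint_powers_iff_notMem f hQ.isRadical).2 hfQ)

theorem IsJ0.exists_isRegularRing_away {R : Type*} [CommRing R] [IsNoetherianRing R]
    (h : IsJ0 R) : ∃ f : R, f ≠ 0 ∧ IsRegularRing (Localization.Away f) := by
  obtain ⟨f, hf0, hf⟩ := h
  refine ⟨f, hf0, ?_⟩
  have : IsNoetherianRing (Localization.Away f) :=
    IsLocalization.isNoetherianRing (Submonoid.powers f) _ inferInstance
  rw [isRegularRing_iff]
  intro Q hQ
  rw [IsRegularLocalRing.localization_atPrime_of_map (R := R) (Submonoid.powers f)]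
  apply hf
  intro hfQ
  exact hQ.ne_top (Ideal.eq_top_of_isUnit_mem _ hfQ (IsLocalization.Away.algebraMap_isUnit f))

theorem IsJ0.of_ringEquiv {R S : Type*} [CommRing R] [CommRing S] (e : R ≃+* S) (h : IsJ0 R) :
    IsJ0 S := by
  obtain ⟨f, hf0, hf⟩ := h
  refine ⟨e f, by simpa using hf0, fun Q hQ hfQ => ?_⟩
  have := hf (Q.comap e) hfQ
  exact .of_ringEquiv (Localization.localRingEquiv (Q.comap e) Q e rfl)

theorem IsJ1.isJ0 {R : Type*} [CommRing R] [IsDomain R] [IsNoetherianRing R] (h : IsJ1 R) :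
    IsJ0 R := by
  have hbot : (⟨⊥, Ideal.isPrime_bot⟩ : PrimeSpectrum R) ∈
      {p : PrimeSpectrum R | IsRegularLocal (Localization.AtPrime p.asIdeal)} := by
    change IsRegularLocal _
    rw [isRegularLocal_iff]
    apply IsRegularLocalRing.of_spanFinrank_maximalIdeal_le
    rw [← Localization.AtPrime.map_eq_maximalIdeal, Ideal.map_bot, Submodule.spanFinrank_bot]
    exact ringKrullDim_nonneg_of_nontrivial
  obtain ⟨_, ⟨f, rfl⟩, hf, hsub⟩ :=
    PrimeSpectrum.isTopologicalBasis_basic_opens.exists_subset_of_mem_open hbot h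
  refine ⟨f, fun h => hf h, fun Q hQ hfQ => ?_⟩
  exact isRegularLocal_iff.1 (@hsub ⟨Q, hQ⟩ hfQ)

theorem IsJ0.mvPolynomial {R σ : Type u} [CommRing R] [IsNoetherianRing R] [Finite σ]
    (h : IsJ0 R) : IsJ0 (MvPolynomial σ R) := by
  obtain ⟨f, hf0, hf⟩ := h.exists_isRegularRing_away
  let : Algebra (MvPolynomial σ R) (MvPolynomial σ (Localization.Away f)) :=
    MvPolynomial.algebraMvPolynomial
  have h1 : IsLocalization ((Submonoid.powers f).map (MvPolynomial.C (σ := σ)))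
      (MvPolynomial σ (Localization.Away f)) := MvPolynomial.isLocalization _ _
  have : IsLocalization.Away (MvPolynomial.C (σ := σ) f)
      (MvPolynomial σ (Localization.Away f)) := by
    rwa [Submonoid.map_powers] at h1
  exact IsJ0.of_isRegularRing_away (R := MvPolynomial σ R)
    (S := MvPolynomial σ (Localization.Away f)) (f := MvPolynomial.C f) (by simpa using hf0)

theorem IsRegularLocalRing.of_etale {R S : Type*} [CommRing R] [CommRing S] [Algebra R S]
    [IsNoetherianRing R] [Algebra.Etale R S] (Q : Ideal S) [Q.IsPrime]
    [IsRegularLocalRing (Localization.AtPrime (Q.under R))] :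
    IsRegularLocalRing (Localization.AtPrime Q) := by
  have : IsNoetherianRing S := Algebra.FiniteType.isNoetherianRing R S
  let := Localization.AtPrime.algebraOfLiesOver (Q.under R) Q
  have hmap := ((Algebra.isUnramifiedAt_iff_map_eq R (Q.under R) Q).1 inferInstance).2
  apply IsRegularLocalRing.of_spanFinrank_maximalIdeal_le
  have h1 : (maximalIdeal (Localization.AtPrime Q)).spanFinrank ≤
      (maximalIdeal (Localization.AtPrime (Q.under R))).spanFinrank := by
    rw [← hmap, IsScalarTower.algebraMap_eq R (Localization.AtPrime (Q.under R)), ← Ideal.map_map,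
      Localization.AtPrime.map_eq_maximalIdeal]
    exact Ideal.spanFinrank_map_le_of_fg _ (IsNoetherian.noetherian _)
  have h2 : (Q.under R).height ≤ Q.height := by
    rw [Ideal.height_eq_height_add_of_liesOver_of_hasGoingDown (Q.under R) Q]
    exact le_self_add
  calc ((maximalIdeal (Localization.AtPrime Q)).spanFinrank : WithBot ℕ∞)
      ≤ (maximalIdeal (Localization.AtPrime (Q.under R))).spanFinrank := by exact_mod_cast h1
    _ = (Q.under R).height := by
      rw [IsRegularLocalRing.spanFinrank_maximalIdeal,
        IsLocalization.AtPrime.ringKrullDim_eq_height (Q.under R)]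
    _ ≤ Q.height := by exact_mod_cast h2
    _ = _ := (IsLocalization.AtPrime.ringKrullDim_eq_height Q _).symm

theorem IsJ0.of_finite {R S : Type u} [CommRing R] [IsNoetherianRing R] [IsDomain R] [CommRing S]
    [IsDomain S] [Algebra R S] [FaithfulSMul R S] [Module.Finite R S] (h : IsJ0 S) : IsJ0 R := by
  obtain ⟨g, hg0, hg⟩ := h
  obtain ⟨a, ha0, hga⟩ := (Algebra.IsIntegral.isIntegral (R := R) g).isAlgebraic.exists_nonzero_dvd
    (mem_nonZeroDivisors_of_ne_zero hg0)
  have : Module.FinitePresentation R S := Module.finitePresentation_of_finite R S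
  obtain ⟨r, hr, hfree, -⟩ := Module.FinitePresentation.exists_free_localizedModule_powers
    (nonZeroDivisors R) (LocalizedModule.mkLinearMap (nonZeroDivisors R) S) (FractionRing R)
  have hfl := (Module.basicOpen_subset_freeLocus_iff (f := r)).2
    (inferInstance : Module.Projective (Localization.Away r) (LocalizedModule.Away r S))
  refine ⟨a * r, mul_ne_zero ha0 (nonZeroDivisors.ne_zero hr), fun q hq hq' => ?_⟩
  have hrq : r ∉ q := fun h => hq' (Ideal.mul_mem_left _ _ h)
  have haq : a ∉ q := fun h => hq' (Ideal.mul_mem_right _ _ h)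
  let M := Algebra.algebraMapSubmonoid S q.primeCompl
  let Rq := Localization.AtPrime q
  let Sq := Localization M
  have hM0 : (0 : S) ∉ M := by
    rintro ⟨x, hx, hx0⟩
    rw [FaithfulSMul.algebraMap_eq_zero_iff] at hx0
    exact hx (hx0 ▸ q.zero_mem)
  have : IsDomain Sq :=
    IsLocalization.isDomain_localization (le_nonZeroDivisors_of_noZeroDivisors hM0)
  have : Module.Free Rq Sq := (Module.mem_freeLocus_of_isLocalization ⟨q, hq⟩ Rq Sq
    (IsScalarTower.toAlgHom R S Sq).toLinearMap).1 (hfl hrq)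
  obtain ⟨Q, hQ⟩ := Ideal.exists_maximal Sq
  have : Algebra.IsIntegral Rq Sq := ⟨isIntegral_localization⟩
  have hQmax : (Q.comap (algebraMap Rq Sq)).IsMaximal :=
    Ideal.isMaximal_comap_of_isIntegral_of_isMaximal (R := Rq) (S := Sq) Q
  have hQq : (Q.under S).under R = q := by
    rw [Ideal.under_under, ← Ideal.under_under (B := Rq), Ideal.under_def (A := Rq),
      IsLocalRing.eq_maximalIdeal hQmax]
    exact Localization.AtPrime.under_maximalIdeal
  have hgQ : g ∉ Q.under S := by
    intro h
    apply haq
    rw [← hQq]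
    exact Ideal.mem_of_dvd (Q.under S) hga h
  have hreg : IsRegularLocalRing (Localization.AtPrime Q) :=
    (IsRegularLocalRing.localization_atPrime_of_map M Q).2 (hg _ hgQ)
  have : Module.Flat Rq (Localization.AtPrime Q) := Module.Flat.trans Rq Sq _
  have : IsLocalHom (algebraMap Rq (Localization.AtPrime Q)) := by
    refine ⟨fun x hx => ?_⟩
    by_contra hxu
    have hxQ : algebraMap Rq Sq x ∈ Q := by
      rw [← Ideal.mem_comap, IsLocalRing.eq_maximalIdeal hQmax]
      exact hxu
    rw [IsScalarTower.algebraMap_apply Rq Sq (Localization.AtPrime Q),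
      IsLocalization.AtPrime.isUnit_to_map_iff _ Q] at hx
    exact hx hxQ
  exact IsRegularLocalRing.of_flat (S := Localization.AtPrime Q)

theorem Algebra.isSeparable_fractionRing_of_adjoin_eq_top {R D K L : Type*} [CommRing R]
    [CommRing D] [Algebra R D] [Field K] [Field L] [Algebra R K] [Algebra D L] [Algebra K L]
    [Algebra R L] [IsScalarTower R K L] [IsScalarTower R D L] [IsFractionRing D L] {S : Set D}
    (hS : Algebra.adjoin R S = ⊤) (h : ∀ s ∈ S, IsSeparable K (algebraMap D L s)) :
    Algebra.IsSeparable K L := by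
  have hD (d : D) : algebraMap D L d ∈ separableClosure K L := by
    have hd : d ∈ Algebra.adjoin R S := hS ▸ Algebra.mem_top
    induction hd using Algebra.adjoin_induction with
    | mem s hs => exact h s hs
    | algebraMap r =>
      rw [← IsScalarTower.algebraMap_apply, IsScalarTower.algebraMap_apply R K L]
      exact IntermediateField.algebraMap_mem _ _
    | add x y _ _ hx hy => rw [map_add]; exact add_mem hx hy
    | mul x y _ _ hx hy => rw [map_mul]; exact mul_mem hx hy
  refine (separableClosure.eq_top_iff K L).1 (top_unique fun x _ => ?_)
  obtain ⟨a, b, hb, rfl⟩ := IsFractionRing.div_surjective (A := D) x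
  exact div_mem (hD a) (hD b)

theorem IsJ0.of_isSimpleRootOver {R D Ω : Type u} [CommRing R] [IsNoetherianRing R] [IsDomain R]
    [CommRing D] [IsDomain D] [Algebra R D] [FaithfulSMul R D] [Field Ω] [Algebra D Ω]
    [FaithfulSMul D Ω] {S : Set D} (hfin : S.Finite) (hS : Algebra.adjoin R S = ⊤)
    (h : ∀ s ∈ S, IsSimpleRootOver (algebraMap D Ω '' Set.range (algebraMap R D))
      (algebraMap D Ω s)) (hR : IsJ0 R) : IsJ0 D := by
  have hft : Algebra.FiniteType R D := ⟨⟨hfin.toFinset, by simpa using hS⟩⟩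
  have : IsNoetherianRing D := Algebra.FiniteType.isNoetherianRing R D
  have : Algebra.FinitePresentation R D := Algebra.FinitePresentation.of_finiteType.1 hft
  let := FractionRing.liftAlgebra R (FractionRing D)
  have : Algebra.IsSeparable (FractionRing R) (FractionRing D) := by
    refine Algebra.isSeparable_fractionRing_of_adjoin_eq_top hS fun s hs => ?_
    have h1 : IsSimpleRootOver (algebraMap D (FractionRing D) '' Set.range (algebraMap R D))
        (algebraMap D (FractionRing D) s) := by
      apply IsSimpleRootOver.of_map
        (IsFractionRing.lift (K := FractionRing D) (FaithfulSMul.algebraMap_injective D Ω))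
      simpa only [Set.image_image, IsFractionRing.lift_algebraMap] using h s hs
    refine (h1.mono ?_).isSeparable
    rintro _ ⟨_, ⟨r, rfl⟩, rfl⟩
    exact ⟨algebraMap R _ r, by simp only [← IsScalarTower.algebraMap_apply]⟩
  have h1 : Algebra.FormallyEtale (FractionRing R) (FractionRing D) := .of_isSeparable _ _
  have h2 : Algebra.FormallyEtale R (FractionRing R) := .of_isLocalization (nonZeroDivisors R)
  have h3 : Algebra.FormallyEtale R (FractionRing D) := .comp R (FractionRing R) _
  have : IsFractionRing D (Localization.AtPrime (⊥ : Ideal D)) := by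
    rw [IsFractionRing, ← Ideal.primeCompl_bot]
    infer_instance
  have : Algebra.IsEtaleAt R (⊥ : Ideal D) := Algebra.FormallyEtale.of_equiv
    ((IsLocalization.algEquiv (nonZeroDivisors D) (FractionRing D)
      (Localization.AtPrime (⊥ : Ideal D))).restrictScalars R)
  obtain ⟨f, hf0, hf⟩ := Algebra.exists_etale_of_isEtaleAt (R := R) (⊥ : Ideal D)
  obtain ⟨r, hr0, hr⟩ := hR
  refine ⟨f * algebraMap R D r, mul_ne_zero hf0 (by simpa using hr0), fun Q hQ hfQ => ?_⟩
  have hdisj : Disjoint (Submonoid.powers f : Set D) (Q : Set D) :=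
    (Ideal.disjoint_powers_iff_notMem f hQ.isRadical).2 fun h => hfQ (Ideal.mul_mem_right _ _ h)
  let Q' := Q.map (algebraMap D (Localization.Away f))
  have hQ' : Q'.IsPrime := IsLocalization.isPrime_of_isPrime_disjoint _ _ Q hQ hdisj
  have hQQ' : Q'.under D = Q := IsLocalization.under_map_of_isPrime_disjoint _ _ hQ hdisj
  have hrQ : r ∉ Q'.under R := by
    rw [← Ideal.under_under (B := D), hQQ']
    exact fun h => hfQ (Ideal.mul_mem_left _ _ h)
  have := hr _ hrQ
  have h4 := (IsRegularLocalRing.localization_atPrime_of_map (Submonoid.powers f) Q').1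
    (IsRegularLocalRing.of_etale (R := R) Q')
  have key (I : Ideal D) [I.IsPrime] (hI : I = Q)
      (h : IsRegularLocalRing (Localization.AtPrime I)) :
      IsRegularLocalRing (Localization.AtPrime Q) := by
    subst hI
    exact h
  exact key _ hQQ' h4

end GenericRegularity

section FiniteType

theorem Algebra.exists_finite_subset_mem_adjoin_union {R A : Type*} [CommRing R] [CommRing A]
    [Algebra R A] {s t : Set A} {x : A} (hx : x ∈ Algebra.adjoin R (s ∪ t)) :
    ∃ u ⊆ s, u.Finite ∧ x ∈ Algebra.adjoin R (u ∪ t) := by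
  have hmono {u v : Set A} (huv : u ⊆ v) :
      Algebra.adjoin R (u ∪ t) ≤ Algebra.adjoin R (v ∪ t) :=
    Algebra.adjoin_mono (Set.union_subset_union_left t huv)
  induction hx using Algebra.adjoin_induction with
  | mem x hx =>
    rcases hx with hx | hx
    · exact ⟨{x}, by simpa using hx, Set.finite_singleton x, Algebra.subset_adjoin (Or.inl rfl)⟩
    · exact ⟨∅, Set.empty_subset s, Set.finite_empty, Algebra.subset_adjoin (Or.inr hx)⟩
  | algebraMap r => exact ⟨∅, Set.empty_subset s, Set.finite_empty, Subalgebra.algebraMap_mem _ r⟩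
  | add x y _ _ hx hy =>
    obtain ⟨u, hu, hu', hx⟩ := hx
    obtain ⟨v, hv, hv', hy⟩ := hy
    exact ⟨u ∪ v, Set.union_subset hu hv, hu'.union hv',
      add_mem (hmono Set.subset_union_left hx) (hmono Set.subset_union_right hy)⟩
  | mul x y _ _ hx hy =>
    obtain ⟨u, hu, hu', hx⟩ := hx
    obtain ⟨v, hv, hv', hy⟩ := hy
    exact ⟨u ∪ v, Set.union_subset hu hv, hu'.union hv',
      mul_mem (hmono Set.subset_union_left hx) (hmono Set.subset_union_right hy)⟩

theorem Algebra.exists_smul_mem_adjoin_integralClosure_union {A K Ω : Type*} [CommRing A]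
    [IsDomain A] [Field K] [Field Ω] [Algebra A K] [Algebra A Ω] [Algebra K Ω]
    [IsScalarTower A K Ω] [Algebra.IsAlgebraic A K] {Y : Set Ω} {x : Ω}
    (hx : x ∈ Algebra.adjoin K Y) :
    ∃ a : A, a ≠ 0 ∧ a • x ∈ Algebra.adjoin A ((integralClosure A Ω : Set Ω) ∪ Y) := by
  induction hx using Algebra.adjoin_induction with
  | mem x hx => exact ⟨1, one_ne_zero, by
      rw [one_smul]
      exact Algebra.subset_adjoin (Or.inr hx)⟩
  | algebraMap r =>
    obtain ⟨a, ha, h⟩ := (Algebra.IsAlgebraic.isAlgebraic (R := A) r).exists_integral_multiple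
    refine ⟨a, ha, Algebra.subset_adjoin (Or.inl ?_)⟩
    rw [← algebraMap.coe_smul]
    exact h.algebraMap
  | add x y _ _ hx hy =>
    obtain ⟨a, ha, hx⟩ := hx
    obtain ⟨b, hb, hy⟩ := hy
    refine ⟨a * b, mul_ne_zero ha hb, ?_⟩
    have h1 : (a * b) • (x + y) = b • a • x + a • b • y := by
      rw [smul_add, smul_smul, smul_smul, mul_comm b]
    rw [h1]
    exact add_mem (Subalgebra.smul_mem _ hx b) (Subalgebra.smul_mem _ hy a)
  | mul x y _ _ hx hy =>
    obtain ⟨a, ha, hx⟩ := hx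
    obtain ⟨b, hb, hy⟩ := hy
    refine ⟨a * b, mul_ne_zero ha hb, ?_⟩
    rw [← smul_mul_smul_comm]
    exact mul_mem hx hy

theorem IsJ0.adjoin_of_isSimpleRootOver {A Ω : Type u} [CommRing A] [IsNoetherianRing A]
    [IsDomain A] [Field Ω] [Algebra A Ω] [FaithfulSMul A Ω] {S t : Set Ω} (hS : S.Finite)
    (htS : t ⊆ S) (ht : AlgebraicIndependent A ((↑) : t → Ω))
    (h : ∀ s ∈ S, IsSimpleRootOver (Algebra.adjoin A t : Set Ω) s) (hA : IsJ0 A) :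
    IsJ0 (Algebra.adjoin A S) := by
  have : Finite t := hS.subset htS
  let D := Algebra.adjoin A S
  let x : t → D := fun i => ⟨i, Algebra.subset_adjoin (htS i.2)⟩
  let φ : MvPolynomial t A →ₐ[A] D := MvPolynomial.aeval x
  let := φ.toAlgebra
  have hφ (p : MvPolynomial t A) : (φ p : Ω) = MvPolynomial.aeval ((↑) : t → Ω) p := by
    have h1 : D.val.comp φ = MvPolynomial.aeval ((↑) : t → Ω) :=
      MvPolynomial.algHom_ext fun i => by simp [φ, x]
    exact DFunLike.congr_fun h1 p
  have : FaithfulSMul (MvPolynomial t A) D := by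
    rw [faithfulSMul_iff_algebraMap_injective]
    intro p q hpq
    apply ht
    rw [← hφ, ← hφ]
    exact congrArg Subtype.val hpq
  have : IsScalarTower A (MvPolynomial t A) D := .of_algHom φ
  refine IsJ0.of_isSimpleRootOver (R := MvPolynomial t A) (Ω := Ω) (S := D.val ⁻¹' S)
    (hS.preimage Subtype.val_injective.injOn) ?_ ?_ hA.mvPolynomial
  · have h1 : Algebra.adjoin A (D.val ⁻¹' S) = ⊤ := Algebra.adjoin_adjoin_coe_preimage
    have h2 : Algebra.adjoin A (D.val ⁻¹' S) ≤
        (Algebra.adjoin (MvPolynomial t A) (D.val ⁻¹' S)).restrictScalars A :=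
      Algebra.adjoin_le Algebra.subset_adjoin
    rw [h1] at h2
    exact top_unique fun d _ => h2 Algebra.mem_top
  · intro s hs
    refine (h s hs).mono ?_
    intro y hy
    rw [Algebra.adjoin_eq_range] at hy
    obtain ⟨p, rfl⟩ := hy
    exact ⟨φ p, ⟨p, rfl⟩, hφ p⟩

theorem IsJ0.adjoin_of_forall_finite {A Ω : Type u} [CommRing A] [IsNoetherianRing A]
    [IsDomain A] [Field Ω] [IsAlgClosed Ω] [Algebra A Ω] [FaithfulSMul A Ω]
    (h : ∀ (B : Type u) [CommRing B] [Algebra A B], Module.Finite A B → IsJ1 B)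
    {S : Set Ω} (hS : S.Finite) : IsJ0 (Algebra.adjoin A S) := by
  let := FractionRing.liftAlgebra A Ω
  have : Algebra.IsAlgebraic A (FractionRing A) := IsLocalization.isAlgebraic _ (nonZeroDivisors A)
  let K := algebraicClosure (FractionRing A) Ω
  have : IsAlgClosed K := IsAlgClosure.isAlgClosed (FractionRing A)
  have : IsScalarTower A K Ω := .to₁₃₄ A (FractionRing A) K Ω
  have : FaithfulSMul A K := .tower_bot A K Ω
  have : Algebra.IsAlgebraic A K := .trans A (FractionRing A) K
  obtain ⟨Y, hYS, hY, hsimple⟩ :=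
    exists_subset_algebraicIndependent_and_isSimpleRootOver (k := K) hS
  have hC (s : S) : ∃ C ⊆ (integralClosure A Ω : Set Ω), C.Finite ∧
      IsSimpleRootOver (Algebra.adjoin A (C ∪ Y) : Set Ω) s.1 := by
    have h1 := (hsimple s s.2).of_forall_exists_mul_mem
      (Algebra.adjoin A ((integralClosure A Ω : Set Ω) ∪ Y)).toSubring fun c hc => by
        obtain ⟨a, ha, hac⟩ := Algebra.exists_smul_mem_adjoin_integralClosure_union (A := A) hc
        refine ⟨algebraMap A Ω a, Subalgebra.algebraMap_mem _ a, by simpa using ha, ?_⟩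
        rwa [← Algebra.smul_def]
    obtain ⟨F, hF, hFfin, hFs⟩ := h1.exists_finite
    choose C hCT hCfin hC using fun x : F => Algebra.exists_finite_subset_mem_adjoin_union (hF x.2)
    have : Finite F := hFfin
    refine ⟨⋃ x, C x, Set.iUnion_subset hCT, Set.finite_iUnion hCfin, hFs.mono fun x hx => ?_⟩
    exact Algebra.adjoin_mono (Set.union_subset_union_left Y (Set.subset_iUnion C ⟨x, hx⟩))
      (hC ⟨x, hx⟩)
  choose C hCT hCfin hC using hC
  have : Finite S := hS
  let T := ⋃ s, C s
  have hT : ∀ x ∈ T, IsIntegral A x := Set.iUnion_subset hCT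
  have hTfin : T.Finite := Set.finite_iUnion hCfin
  let A' := Algebra.adjoin A T
  have : Module.Finite A A' := Algebra.finite_adjoin_of_finite_of_isIntegral hTfin hT
  have : IsNoetherianRing A' := IsNoetherianRing.of_finite A A'
  have hYA : AlgebraicIndependent A ((↑) : Y → Ω) :=
    hY.restrictScalars (FaithfulSMul.algebraMap_injective A K)
  have hYA' : AlgebraicIndependent A' ((↑) : Y → Ω) := hYA.extendScalars A'
  have hJ : IsJ0 (Algebra.adjoin A' S) := by
    refine IsJ0.adjoin_of_isSimpleRootOver hS hYS hYA' (fun s hs => ?_) (h A' inferInstance).isJ0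
    refine (hC ⟨s, hs⟩).mono ?_
    have h1 := Algebra.adjoin_union_eq_adjoin_adjoin A T Y
    intro x hx
    have h2 : x ∈ Algebra.adjoin A (T ∪ Y) :=
      Algebra.adjoin_mono (Set.union_subset_union_left Y (Set.subset_iUnion C ⟨s, hs⟩)) hx
    rwa [h1] at h2
  let D := Algebra.adjoin A S
  let E := Algebra.adjoin D T
  have : Algebra.FiniteType A D := ⟨(Subalgebra.fg_top D).2 ⟨hS.toFinset, by simp [D]⟩⟩
  have : IsNoetherianRing D := Algebra.FiniteType.isNoetherianRing A D
  have : Module.Finite D E :=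
    Algebra.finite_adjoin_of_finite_of_isIntegral hTfin fun x hx => (hT x hx).tower_top
  have : FaithfulSMul D E := by
    rw [faithfulSMul_iff_algebraMap_injective]
    exact fun x y hxy => Subtype.ext (congrArg (Subtype.val : E → Ω) hxy)
  have hE : (Algebra.adjoin A' S).restrictScalars A = E.restrictScalars A := by
    rw [← Algebra.adjoin_union_eq_adjoin_adjoin, ← Algebra.adjoin_union_eq_adjoin_adjoin,
      Set.union_comm]
  exact (hJ.of_ringEquiv (Subalgebra.equivOfEq _ _ hE).toRingEquiv : IsJ0 E).of_finite

theorem IsJ0.of_finiteType {A D : Type u} [CommRing A] [IsNoetherianRing A] [CommRing D]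
    [IsDomain D] [Algebra A D] [Algebra.FiniteType A D]
    (h : ∀ (B : Type u) [CommRing B] [Algebra A B], Module.Finite A B → IsJ1 B) : IsJ0 D := by
  let I := RingHom.ker (algebraMap A D)
  let A₀ := A ⧸ I
  let : Algebra A₀ D := (Ideal.Quotient.lift I (algebraMap A D) fun _ h => h).toAlgebra
  have : IsScalarTower A A₀ D := .of_algebraMap_eq fun _ => rfl
  have : I.IsPrime := RingHom.ker_isPrime _
  have : IsDomain A₀ := Ideal.Quotient.isDomain I
  have : FaithfulSMul A₀ D := by
    rw [faithfulSMul_iff_algebraMap_injective]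
    exact RingHom.kerLift_injective _
  let Ω := AlgebraicClosure (FractionRing D)
  have : FaithfulSMul D Ω := .trans D (FractionRing D) Ω
  have : FaithfulSMul A₀ Ω := .trans A₀ D Ω
  have : Algebra.FiniteType A₀ D := .of_restrictScalars_finiteType A A₀ D
  obtain ⟨S, hS⟩ := Algebra.FiniteType.out (R := A₀) (A := D)
  let φ := IsScalarTower.toAlgHom A₀ D Ω
  have hφ : Function.Injective φ := FaithfulSMul.algebraMap_injective D Ω
  have hr : Algebra.adjoin A₀ (φ '' S) = φ.range := by
    rw [← AlgHom.map_adjoin, hS, Algebra.map_top]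
  have hJ : IsJ0 (Algebra.adjoin A₀ (φ '' S)) := by
    refine IsJ0.adjoin_of_forall_finite (fun B _ _ hB => ?_) (S.finite_toSet.image φ)
    let : Algebra A B := Algebra.compHom B (algebraMap A A₀)
    have : IsScalarTower A A₀ B := .of_algebraMap_eq fun _ => rfl
    exact h B (.trans A₀ B)
  rw [hr] at hJ
  exact hJ.of_ringEquiv (AlgEquiv.ofInjective φ hφ).symm.toRingEquiv

end FiniteType

/-- **J-2 can be tested on finite algebras.**
Let `A` be a noetherian ring.  Then `A` is J-2 — every finitely generated
`A`-algebra is J-1 (has open regular locus) — if and only if every finite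
`A`-algebra is J-1. -/
theorem isJ2_iff_finite {A : Type} [CommRing A] [IsNoetherianRing A] :
    (∀ (B : Type) [CommRing B] [Algebra A B], Algebra.FiniteType A B → IsJ1 B) ↔
      (∀ (B : Type) [CommRing B] [Algebra A B], Module.Finite A B → IsJ1 B) := by
  refine ⟨fun h B _ _ _ => h B inferInstance, fun h B _ _ _ => ?_⟩
  have : IsNoetherianRing B := Algebra.FiniteType.isNoetherianRing A B
  exact isJ1_of_forall_isJ0_quotient fun P _ => IsJ0.of_finiteType h
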